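/- Let Φ be a random power-law k-SAT formula with n variables, m ∈ Ω(n) clauses, k ≥ 3, and power-law exponent β > (2k−3)/(k−2), with Δ = m/n large enough so that Φ is unsatisfiable with at least constant probability. For any constant ε with 0 < ε < (k−1)(β−2)/(β−1) − 1 and Δ ∈ o((n/log n)^ε), asymptotically almost surely Φ has tree-like resolution size exp(Ω(n · Δ^{−1/ε})). -/

import Mathlib

open Filter Finset

namespace PLSAT

/-- Weight of variable `i` (0-indexed): variable `i+1` has weight `(i+1)^{-1/(β-1)}`. -/
noncomputable def wt (β : ℝ) {n : ℕ} (i : Fin n) : ℝ :=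
  ((i : ℕ) + 1 : ℝ) ^ (-(1 : ℝ) / (β - 1))

noncomputable def totalWt (β : ℝ) (n : ℕ) : ℝ := ∑ i : Fin n, wt β i

/-- A sampled clause: an ordered tuple of `k` variables together with their signs. -/
abbrev Draw (n k : ℕ) := (Fin k → Fin n) × (Fin k → Bool)

/-- A sampled formula: `m` independently sampled clauses. -/
abbrev Formula (n m k : ℕ) := Fin m → Draw n k

/-- Probability mass of one sampled clause: the `k` distinct variables are drawn
without replacement with probabilities proportional to their weights, and each of
the `k` signs is chosen independently uniformly at random. -/
noncomputable def clauseMass (β : ℝ) {n : ℕ} (k : ℕ) (c : Draw n k) : ℝ :=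
  if Function.Injective c.1 then
    (1 / 2) ^ k *
      ∏ j : Fin k,
        wt β (c.1 j) /
          (totalWt β n - ∑ l ∈ Finset.univ.filter (fun l : Fin k => l < j), wt β (c.1 l))
  else 0

/-- Probability mass of a formula: clauses are sampled independently. -/
noncomputable def mass (β : ℝ) {n m k : ℕ} (φ : Formula n m k) : ℝ :=
  ∏ i : Fin m, clauseMass β k (φ i)

/-- Probability of an event in the power-law random `k`-SAT model. -/
noncomputable def Pr (β : ℝ) (n m k : ℕ) (E : Set (Formula n m k)) : ℝ :=
  ∑ φ : Formula n m k, E.indicator (mass β) φ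

def Satisfies {n k : ℕ} (a : Fin n → Bool) (c : Draw n k) : Prop :=
  ∃ j : Fin k, a (c.1 j) = c.2 j

def Unsat {n m k : ℕ} (φ : Formula n m k) : Prop :=
  ¬ ∃ a : Fin n → Bool, ∀ i : Fin m, Satisfies a (φ i)

/-- A resolution clause: a finite set of literals. -/
abbrev RClause (n : ℕ) := Finset (Fin n × Bool)

def toRClause {n k : ℕ} (c : Draw n k) : RClause n :=
  Finset.image (fun j => (c.1 j, c.2 j)) Finset.univ

def cnf {n m k : ℕ} (φ : Formula n m k) : Set (RClause n) :=
  Set.range fun i : Fin m => toRClause (φ i)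

/-- `C` is obtained by resolving `A` and `B` on some variable. -/
def IsResolvent {n : ℕ} (A B C : RClause n) : Prop :=
  ∃ x : Fin n, (x, true) ∈ A ∧ (x, false) ∈ B ∧
    C = A.erase (x, true) ∪ B.erase (x, false)

/-- `L` is a resolution refutation of the clause set `S`. -/
def IsRefutation {n : ℕ} (S : Set (RClause n)) (L : List (RClause n)) : Prop :=
  (∀ i : Fin L.length, L.get i ∈ S ∨
      ∃ j l : Fin L.length, (j : ℕ) < (i : ℕ) ∧ (l : ℕ) < (i : ℕ) ∧
        IsResolvent (L.get j) (L.get l) (L.get i)) ∧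
  (∅ : RClause n) ∈ L

def HasRefutationOfWidth {n : ℕ} (S : Set (RClause n)) (w : ℕ) : Prop :=
  ∃ L : List (RClause n), IsRefutation S L ∧ ∀ C ∈ L, C.card ≤ w

/-- The resolution width of `φ` is at least `b`: every resolution refutation
contains a clause of size at least `b`. -/
def widthAtLeast {n m k : ℕ} (b : ℝ) (φ : Formula n m k) : Prop :=
  ∀ w : ℕ, HasRefutationOfWidth (cnf φ) w → b ≤ (w : ℝ)

/-- Tree-like resolution derivations: `TreeDeriv S C s` holds if there is a tree-like
resolution derivation of clause `C` from the clause set `S` with `s` nodes. -/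
inductive TreeDeriv {n : ℕ} (S : Set (RClause n)) : RClause n → ℕ → Prop
  | ax : ∀ C ∈ S, TreeDeriv S C 1
  | res : ∀ (A B C : RClause n) (sa sb : ℕ), IsResolvent A B C →
      TreeDeriv S A sa → TreeDeriv S B sb → TreeDeriv S C (sa + sb + 1)

/-- The neighborhood of a set of clauses in the clause-variable incidence graph. -/
def nbhd {n m k : ℕ} (φ : Formula n m k) (Cs : Finset (Fin m)) : Finset (Fin n) :=
  Cs.biUnion fun i => Finset.image (φ i).1 Finset.univ

/-- `G(φ)` is an `(r, c)`-bipartite expander. -/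
def IsBipartiteExpander {n m k : ℕ} (φ : Formula n m k) (r : ℕ) (c : ℝ) : Prop :=
  ∀ Cs : Finset (Fin m), Cs.card ≤ r → (1 + c) * (Cs.card : ℝ) ≤ ((nbhd φ Cs).card : ℝ)

/-- The variables occurring in exactly one clause of `Cs`. -/
def uniqueVars {n m k : ℕ} (φ : Formula n m k) (Cs : Finset (Fin m)) : Finset (Fin n) :=
  (nbhd φ Cs).filter fun v =>
    (Cs.filter fun i => v ∈ Finset.image (φ i).1 Finset.univ).card = 1

end PLSAT

namespace PLSAT

/-- The assignment `a` falsifies every literal of `C`. -/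
def Falsifies {n : ℕ} (a : Fin n → Bool) (C : RClause n) : Prop :=
  ∀ l ∈ C, a l.1 = !l.2

/-- The clauses of `φ` indexed by `Cs` semantically imply `C`. -/
def Implies {n m k : ℕ} (φ : Formula n m k) (Cs : Finset (Fin m)) (C : RClause n) : Prop :=
  ¬ ∃ a : Fin n → Bool, Falsifies a C ∧ ∀ i ∈ Cs, Satisfies a (φ i)

/-- No set of at most `r` clauses of `φ` implies `C`. -/
def Hard {n m k : ℕ} (φ : Formula n m k) (r : ℕ) (C : RClause n) : Prop :=
  ∀ Cs : Finset (Fin m), Cs.card ≤ r → ¬ Implies φ Cs C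

theorem mem_nbhd {n m k : ℕ} {φ : Formula n m k} {Cs : Finset (Fin m)} {v : Fin n} :
    v ∈ nbhd φ Cs ↔ ∃ i ∈ Cs, ∃ j, (φ i).1 j = v := by
  simp [nbhd]

theorem Satisfies.congr {n k : ℕ} {a b : Fin n → Bool} {c : Draw n k}
    (h : Satisfies a c) (hab : ∀ j, a (c.1 j) = b (c.1 j)) : Satisfies b c := by
  obtain ⟨j, hj⟩ := h
  exact ⟨j, (hab j).symm.trans hj⟩

theorem Implies.mono {n m k : ℕ} {φ : Formula n m k} {Cs Ds : Finset (Fin m)} {C D : RClause n}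
    (h : Implies φ Cs C) (hCs : Cs ⊆ Ds) (hC : C ⊆ D) : Implies φ Ds D := by
  rintro ⟨a, ha, hs⟩
  exact h ⟨a, fun l hl => ha l (hC hl), fun i hi => hs i (hCs hi)⟩

/-- Tarsi's lemma, relative to a clause `C`: a minimal set of clauses implying `C` has at least
as many clauses as variables outside `C`. -/
theorem card_nbhd_sdiff_le_of_minimal {n m k : ℕ} {φ : Formula n m k} {Cs : Finset (Fin m)}
    {C : RClause n} (h : Implies φ Cs C) (hmin : ∀ Ds, Ds ⊂ Cs → ¬ Implies φ Ds C) :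
    (nbhd φ Cs \ C.image Prod.fst).card ≤ Cs.card := by
  classical
  set N : Finset (Fin m) → Finset (Fin n) := fun T => nbhd φ T \ C.image Prod.fst with hN
  obtain ⟨T, hT, hTmax⟩ := Cs.powerset.exists_max_image
    (fun T => (T.card : ℤ) - (N T).card) ⟨∅, by simp⟩
  rw [Finset.mem_powerset] at hT
  have hNunion : ∀ U, N (T ∪ U) = N T ∪ (N U \ N T) := by
    intro U
    ext v
    simp only [hN, Finset.mem_sdiff, Finset.mem_union, mem_nbhd]
    constructor
    · rintro ⟨⟨i, hi | hi, hv⟩, hC⟩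
      · exact Or.inl ⟨⟨i, hi, hv⟩, hC⟩
      · by_cases hT' : ∃ i ∈ T, ∃ j, (φ i).1 j = v
        · exact Or.inl ⟨hT', hC⟩
        · exact Or.inr ⟨⟨⟨i, hi, hv⟩, hC⟩, fun h' => hT' h'.1⟩
    · rintro (⟨⟨i, hi, hv⟩, hC⟩ | ⟨⟨⟨i, hi, hv⟩, hC⟩, -⟩)
      · exact ⟨⟨i, Or.inl hi, hv⟩, hC⟩
      · exact ⟨⟨i, Or.inr hi, hv⟩, hC⟩
  rcases eq_or_ne T Cs with rfl | hne
  · have h0 := hTmax ∅ (by simp)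
    have : N ∅ = ∅ := by simp [hN, nbhd]
    simp only [this, Finset.card_empty] at h0
    have h1 : ((N T).card : ℤ) ≤ T.card := by push_cast at h0; linarith
    exact_mod_cast h1
  exfalso
  have hTs : T ⊂ Cs := lt_of_le_of_ne hT hne
  obtain ⟨a, haC, haT⟩ := not_not.1 (hmin T hTs)
  have hall : ∀ s : Finset (↥(Cs \ T)),
      s.card ≤ (s.biUnion fun i => N {i.1} \ N T).card := by
    intro s
    set U : Finset (Fin m) := s.map (Function.Embedding.subtype _) with hU
    have hUcard : U.card = s.card := by simp [hU]
    have hUsub : U ⊆ Cs \ T := by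
      intro i hi
      rw [hU, Finset.mem_map] at hi
      obtain ⟨i', -, rfl⟩ := hi
      exact i'.2
    have hNU : (s.biUnion fun i => N {i.1} \ N T) = N U \ N T := by
      ext v
      simp only [hN, hU, Finset.mem_biUnion, Finset.mem_sdiff, mem_nbhd, Finset.mem_map,
        Finset.mem_singleton]
      constructor
      · rintro ⟨i, hi, ⟨⟨_, rfl, hv⟩, hC⟩, h'⟩
        exact ⟨⟨⟨i.1, ⟨i, hi, rfl⟩, hv⟩, hC⟩, h'⟩
      · rintro ⟨⟨⟨_, ⟨i, hi, rfl⟩, hv⟩, hC⟩, h'⟩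
        exact ⟨i, hi, ⟨⟨_, rfl, hv⟩, hC⟩, h'⟩
    have hmax := hTmax (T ∪ U) (by
      rw [Finset.mem_powerset]
      exact Finset.union_subset hT (hUsub.trans Finset.sdiff_subset))
    have hdisj : Disjoint T U :=
      (Finset.disjoint_sdiff).mono_right hUsub
    rw [hNunion, Finset.card_union_of_disjoint hdisj,
      Finset.card_union_of_disjoint Finset.disjoint_sdiff] at hmax
    rw [hNU, ← hUcard]
    push_cast at hmax
    have : (U.card : ℤ) ≤ (N U \ N T).card := by linarith
    exact_mod_cast this
  obtain ⟨f, hfinj, hf⟩ := (Finset.all_card_le_biUnion_card_iff_exists_injective _).1 hall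
  have hlit : ∀ i : ↥(Cs \ T), ∃ j, (φ i.1).1 j = f i := by
    intro i
    have := hf i
    simp only [hN, Finset.mem_sdiff, mem_nbhd, Finset.mem_singleton] at this
    obtain ⟨⟨⟨_, rfl, hj⟩, -⟩, -⟩ := this
    exact hj
  choose j hj using hlit
  set b : Fin n → Bool := fun v =>
    if hv : ∃ i, f i = v then (φ (hv.choose).1).2 (j hv.choose) else a v with hb
  have hbf : ∀ i, b (f i) = (φ i.1).2 (j i) := by
    intro i
    have hv : ∃ i', f i' = f i := ⟨i, rfl⟩
    have hc : hv.choose = i := hfinj hv.choose_spec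
    simp only [hb, dif_pos hv]
    rw [hc]
  have hba : ∀ v, (∀ i, f i ≠ v) → b v = a v := by
    intro v hv
    simp only [hb]
    rw [dif_neg (by push Not; exact hv)]
  refine h ⟨b, ?_, ?_⟩
  · intro l hl
    rw [hba l.1, haC l hl]
    intro i hi
    have h1 := hf i
    simp only [hN, Finset.mem_sdiff] at h1
    exact h1.1.2 (hi ▸ Finset.mem_image_of_mem _ hl)
  · intro i hi
    by_cases hiT : i ∈ T
    · refine (haT i hiT).congr fun j' => (hba _ ?_).symm
      intro i' hi'
      have h1 := hf i'
      rw [Finset.mem_sdiff] at h1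
      refine h1.2 ?_
      simp only [hN, Finset.mem_sdiff]
      have h2 := h1.1
      simp only [hN, Finset.mem_sdiff] at h2
      refine ⟨?_, h2.2⟩
      rw [mem_nbhd]
      exact ⟨i, hiT, j', hi'.symm⟩
    · have hi' : i ∈ Cs \ T := Finset.mem_sdiff.2 ⟨hi, hiT⟩
      exact ⟨j ⟨i, hi'⟩, by rw [hj ⟨i, hi'⟩, hbf]⟩

/-- In an expander, a clause implied by few clauses is already implied by a number of clauses
that is proportional to its width. -/
theorem IsBipartiteExpander.exists_implies {n m k : ℕ} {φ : Formula n m k} {r : ℕ} {c : ℝ}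
    (hφ : IsBipartiteExpander φ r c) {Cs : Finset (Fin m)} {C : RClause n} (hr : Cs.card ≤ r)
    (h : Implies φ Cs C) : ∃ Ds : Finset (Fin m), Implies φ Ds C ∧ c * Ds.card ≤ C.card := by
  classical
  obtain ⟨Ds, hDs, hmin⟩ := (Cs.powerset.filter fun Ds => Implies φ Ds C).exists_min_image
    Finset.card ⟨Cs, by simp [h]⟩
  simp only [Finset.mem_filter, Finset.mem_powerset] at hDs hmin
  refine ⟨Ds, hDs.2, ?_⟩
  have h1 := card_nbhd_sdiff_le_of_minimal hDs.2 (fun Es hEs hEs' =>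
    (Finset.card_lt_card hEs).not_ge (hmin Es ⟨hEs.subset.trans hDs.1, hEs'⟩))
  have h2 := hφ Ds ((Finset.card_le_card hDs.1).trans hr)
  have h3 : (nbhd φ Ds).card ≤ (nbhd φ Ds \ C.image Prod.fst).card + (C.image Prod.fst).card := by
    have := Finset.le_card_sdiff (C.image Prod.fst) (nbhd φ Ds)
    omega
  have h4 : (C.image Prod.fst).card ≤ C.card := Finset.card_image_le
  have h5 : ((nbhd φ Ds).card : ℝ) ≤ Ds.card + C.card := by
    exact_mod_cast (by omega : (nbhd φ Ds).card ≤ Ds.card + C.card)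
  linarith

theorem Hard.mono {n m k : ℕ} {φ : Formula n m k} {r : ℕ} {C D : RClause n}
    (h : Hard φ r D) (hC : C ⊆ D) : Hard φ r C :=
  fun Cs hCs hI => h Cs hCs (hI.mono subset_rfl hC)

theorem not_hard_of_mem {n m k : ℕ} {φ : Formula n m k} {r : ℕ} {D : RClause n}
    {x : Fin n} (ht : (x, true) ∈ D) (hf : (x, false) ∈ D) : ¬ Hard φ r D := by
  intro h
  obtain ⟨a, ha, -⟩ := not_not.1 (h ∅ (by simp))
  have h1 := ha _ ht
  have h2 := ha _ hf
  simp_all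

theorem IsBipartiteExpander.hard_empty {n m k : ℕ} {φ : Formula n m k} {r : ℕ} {c : ℝ}
    (hc : 0 < c) (hφ : IsBipartiteExpander φ r c) : Hard φ r ∅ := by
  intro Cs hCs hI
  obtain ⟨Ds, hDs, hcard⟩ := hφ.exists_implies hCs hI
  simp only [Finset.card_empty, Nat.cast_zero] at hcard
  have h0 : (Ds.card : ℝ) = 0 := by
    have : (0 : ℝ) ≤ Ds.card := Nat.cast_nonneg _
    nlinarith
  have h1 : Ds = ∅ := by simpa using h0
  subst h1
  exact hDs ⟨fun _ => true, by simp [Falsifies], by simp⟩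

theorem IsBipartiteExpander.hard_insert {n m k : ℕ} {φ : Formula n m k} {r W : ℕ} {c : ℝ}
    (hc : 0 < c) (hφ : IsBipartiteExpander φ r c) (hW : (W : ℝ) ≤ c * r / 2) {D : RClause n}
    (hD : Hard φ r D) (hcard : D.card < W) (x : Fin n) (b : Bool)
    (hnot : ¬ Hard φ r (insert (x, !b) D)) : Hard φ r (insert (x, b) D) := by
  classical
  by_contra hnot'
  have key : ∀ l, ¬ Hard φ r (insert l D) →
      ∃ Ds : Finset (Fin m), Implies φ Ds (insert l D) ∧ 2 * Ds.card ≤ r := by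
    intro l hl
    simp only [Hard, not_forall, not_not] at hl
    obtain ⟨Cs, hCs, hI⟩ := hl
    obtain ⟨Ds, hDs, h1⟩ := hφ.exists_implies hCs hI
    refine ⟨Ds, hDs, ?_⟩
    have h2 : ((insert l D).card : ℝ) ≤ W := by
      exact_mod_cast (Finset.card_insert_le l D).trans hcard
    have h3 : c * (2 * Ds.card) ≤ c * r := by linarith
    exact_mod_cast le_of_mul_le_mul_left h3 hc
  obtain ⟨Ds, hDs, h1⟩ := key _ hnot
  obtain ⟨Es, hEs, h2⟩ := key _ hnot'
  refine hD (Ds ∪ Es) ((Finset.card_union_le _ _).trans (by omega)) ?_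
  rintro ⟨a, ha, hs⟩
  by_cases hax : a x = !b
  · refine hEs ⟨a, ?_, fun i hi => hs i (Finset.mem_union_right _ hi)⟩
    intro l hl
    rcases Finset.mem_insert.1 hl with rfl | hl
    · exact hax
    · exact ha l hl
  · refine hDs ⟨a, ?_, fun i hi => hs i (Finset.mem_union_left _ hi)⟩
    intro l hl
    rcases Finset.mem_insert.1 hl with rfl | hl
    · simpa using hax
    · exact ha l hl

theorem IsBipartiteExpander.exists_hard_superset {n m k : ℕ} {φ : Formula n m k} {r W : ℕ}
    {c : ℝ} (hc : 0 < c) (hφ : IsBipartiteExpander φ r c) (hW : (W : ℝ) ≤ c * r / 2)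
    {D : RClause n} (hD : Hard φ r D) (C : RClause n)
    (hC : ∀ l ∈ C, ¬ Hard φ r (insert (l.1, !l.2) D)) (hcard : D.card + C.card ≤ W) :
    ∃ E : RClause n, Hard φ r E ∧ D ⊆ E ∧ C ⊆ E ∧ E.card ≤ D.card + C.card := by
  classical
  induction C using Finset.induction_on with
  | empty => exact ⟨D, hD, subset_rfl, by simp, by simp⟩
  | insert l C hl ih =>
    rw [Finset.card_insert_of_notMem hl] at hcard
    obtain ⟨E, hE, hDE, hCE, hEc⟩ :=
      ih (fun l' hl' => hC l' (Finset.mem_insert_of_mem hl')) (by omega)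
    have hnot : ¬ Hard φ r (insert (l.1, !l.2) E) := fun h =>
      hC l (Finset.mem_insert_self _ _) (h.mono (Finset.insert_subset_insert _ hDE))
    refine ⟨insert (l.1, l.2) E, hφ.hard_insert hc hW hE (by omega) l.1 l.2 hnot,
      hDE.trans (Finset.subset_insert _ _), ?_, ?_⟩
    · exact Finset.insert_subset_insert _ hCE
    · rw [Finset.card_insert_of_notMem hl]
      exact (Finset.card_insert_le _ _).trans (by omega)

theorem IsBipartiteExpander.two_pow_le_of_treeDeriv {n m k : ℕ} {φ : Formula n m k} {r W : ℕ}
    {c : ℝ} (hc : 0 < c) (hφ : IsBipartiteExpander φ r c) (hW : (W : ℝ) ≤ c * r / 2)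
    (hr : 1 ≤ r) {C : RClause n} {s : ℕ} (h : TreeDeriv (cnf φ) C s) :
    ∀ (D : RClause n) (t : ℕ), Hard φ r D → (∀ l ∈ C, ¬ Hard φ r (insert (l.1, !l.2) D)) →
      D.card + k + t ≤ W → 2 ^ t ≤ s := by
  classical
  induction h with
  | ax C hC =>
    intro D t hD hCD hcard
    exfalso
    obtain ⟨i, hi⟩ := hC
    change toRClause (φ i) = C at hi
    subst hi
    have hk : (toRClause (φ i)).card ≤ k :=
      Finset.card_image_le.trans (by simp)
    obtain ⟨E, hE, -, hCE, -⟩ := hφ.exists_hard_superset hc hW hD _ hCD (by omega)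
    obtain ⟨a, ha, hs⟩ := not_not.1 (hE {i} (by simpa using hr))
    obtain ⟨j, hj⟩ := hs i (by simp)
    have := ha ((φ i).1 j, (φ i).2 j) (hCE (Finset.mem_image_of_mem _ (Finset.mem_univ j)))
    simp [hj] at this
  | res A B C sa sb hres hA hB ihA ihB =>
    intro D t hD hCD hcard
    obtain ⟨x, hxA, hxB, rfl⟩ := hres
    have hmono : ∀ D' : RClause n, D ⊆ D' → ∀ l ∈ A.erase (x, true) ∪ B.erase (x, false),
        ¬ Hard φ r (insert (l.1, !l.2) D') := fun D' hD' l hl h' =>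
      hCD l hl (h'.mono (Finset.insert_subset_insert _ hD'))
    have hAD : ∀ D' : RClause n, D ⊆ D' → ¬ Hard φ r (insert (x, false) D') →
        ∀ l ∈ A, ¬ Hard φ r (insert (l.1, !l.2) D') := by
      intro D' hD' hx l hl
      by_cases hlx : l = (x, true)
      · subst hlx; exact hx
      · exact hmono D' hD' l (Finset.mem_union_left _ (Finset.mem_erase.2 ⟨hlx, hl⟩))
    have hBD : ∀ D' : RClause n, D ⊆ D' → ¬ Hard φ r (insert (x, true) D') →
        ∀ l ∈ B, ¬ Hard φ r (insert (l.1, !l.2) D') := by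
      intro D' hD' hx l hl
      by_cases hlx : l = (x, false)
      · subst hlx; exact hx
      · exact hmono D' hD' l (Finset.mem_union_right _ (Finset.mem_erase.2 ⟨hlx, hl⟩))
    by_cases hf : Hard φ r (insert (x, false) D)
    · by_cases ht : Hard φ r (insert (x, true) D)
      · cases t with
        | zero => simp
        | succ t =>
          have h1 := ihA (insert (x, true) D) t ht
            (hAD _ (Finset.subset_insert _ _) (not_hard_of_mem (x := x) (by simp) (by simp)))
            (by have := Finset.card_insert_le (x, true) D; omega)
          have h2 := ihB (insert (x, false) D) t hf
            (hBD _ (Finset.subset_insert _ _) (not_hard_of_mem (x := x) (by simp) (by simp)))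
            (by have := Finset.card_insert_le (x, false) D; omega)
          rw [pow_succ]
          omega
      · have := ihB D t hD (hBD D subset_rfl ht) hcard
        omega
    · have := ihA D t hD (hAD D subset_rfl hf) hcard
      omega

/-- Tree-like resolution size lower bound for expanders. -/
theorem IsBipartiteExpander.two_pow_le_treeSize {n m k : ℕ} {φ : Formula n m k} {r t : ℕ}
    {c : ℝ} (hc : 0 < c) (hφ : IsBipartiteExpander φ r c) (ht : ((k + t : ℕ) : ℝ) ≤ c * r / 2)
    (hr : 1 ≤ r) {s : ℕ} (h : TreeDeriv (cnf φ) (∅ : RClause n) s) : 2 ^ t ≤ s :=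
  hφ.two_pow_le_of_treeDeriv hc ht hr h ∅ t (hφ.hard_empty hc) (by simp) (by simp)

theorem wt_pos (β : ℝ) {n : ℕ} (i : Fin n) : 0 < wt β i := by
  unfold wt; positivity

theorem wt_le_one {β : ℝ} (hβ : 2 < β) {n : ℕ} (i : Fin n) : wt β i ≤ 1 := by
  unfold wt
  refine Real.rpow_le_one_of_one_le_of_nonpos (by simp) ?_
  exact div_nonpos_of_nonpos_of_nonneg (by norm_num) (by linarith)

/-- Tangent line inequality for the concave function `x ↦ x ^ γ`. -/
theorem rpow_add_mul_rpow_sub_one_le {γ : ℝ} (h0 : 0 < γ) (h1 : γ ≤ 1) (t : ℕ) :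
    (t : ℝ) ^ γ + γ * ((t : ℝ) + 1) ^ (γ - 1) ≤ ((t : ℝ) + 1) ^ γ := by
  have ht : (0 : ℝ) < (t : ℝ) + 1 := by positivity
  have hb := rpow_one_add_le_one_add_mul_self (s := -1 / ((t : ℝ) + 1))
    (by rw [le_div_iff₀ ht]; linarith) h0.le h1
  have h2 : 1 + -1 / ((t : ℝ) + 1) = t / (t + 1) := by field_simp; ring
  rw [h2, Real.div_rpow (by positivity) ht.le, div_le_iff₀ (by positivity)] at hb
  rw [Real.rpow_sub_one ht.ne']
  have h3 : (1 + γ * (-1 / ((t : ℝ) + 1))) * (t + 1) ^ γ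
      = (t + 1) ^ γ - γ * ((t + 1) ^ γ / (t + 1)) := by ring
  linarith

/-- A set of `t` variables has weight `O(t ^ γ)`, where `γ = 1 - 1 / (β - 1)`. -/
theorem sum_wt_le {β γ : ℝ} (hγ : 1 + -1 / (β - 1) = γ) (h0 : 0 < γ) (h1 : γ ≤ 1) {n : ℕ}
    (V : Finset (Fin n)) : ∑ i ∈ V, wt β i ≤ (V.card : ℝ) ^ γ / γ := by
  induction V using Finset.induction_on_max with
  | empty => simp [Real.zero_rpow h0.ne']
  | insert a s hs ih =>
    have ha : a ∉ s := fun h => lt_irrefl _ (hs a h)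
    rw [Finset.sum_insert ha, Finset.card_insert_of_notMem ha, Nat.cast_succ]
    have hc : s.card ≤ (a : ℕ) := by
      calc s.card ≤ (Finset.Iio a).card := Finset.card_le_card fun x hx => Finset.mem_Iio.2 (hs x hx)
        _ = a := Fin.card_Iio a
    have hw : wt β a ≤ ((s.card : ℝ) + 1) ^ (γ - 1) := by
      unfold wt
      have : -1 / (β - 1) = γ - 1 := by linarith
      rw [this]
      refine Real.rpow_le_rpow_of_nonpos (Nat.cast_add_one_pos _) ?_ (by linarith)
      have : (s.card : ℝ) ≤ ((a : ℕ) : ℝ) := by exact_mod_cast hc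
      linarith
    have := rpow_add_mul_rpow_sub_one_le h0 h1 s.card
    rw [le_div_iff₀ h0] at ih ⊢
    nlinarith

theorem rpow_le_totalWt {β γ : ℝ} (hγ : 1 + -1 / (β - 1) = γ) (h1 : γ ≤ 1) {n : ℕ}
    (hn : 0 < n) : (n : ℝ) ^ γ ≤ totalWt β n := by
  have hn' : (0 : ℝ) < n := by exact_mod_cast hn
  have : ∀ i : Fin n, (n : ℝ) ^ (γ - 1) ≤ wt β i := by
    intro i
    unfold wt
    have : -1 / (β - 1) = γ - 1 := by linarith
    rw [this]
    refine Real.rpow_le_rpow_of_nonpos (by positivity) ?_ (by linarith)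
    exact_mod_cast i.2
  have h := Finset.card_nsmul_le_sum Finset.univ _ _ fun i _ => this i
  rw [Finset.card_univ, Fintype.card_fin, nsmul_eq_mul, Real.rpow_sub_one hn'.ne'] at h
  rw [mul_div_cancel₀ _ hn'.ne'] at h
  exact h

/-- Sampling without replacement defines a probability distribution. -/
theorem sum_prod_div_eq_one {n : ℕ} {w : Fin n → ℝ} (hw : ∀ i, 0 < w i) :
    ∀ k : ℕ, k ≤ n → ∑ x : Fin k → Fin n, (if Function.Injective x then
      ∏ j, w (x j) / (∑ i, w i - ∑ l ∈ Finset.univ.filter (fun l : Fin k => l < j), w (x l))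
      else 0) = 1 := by
  intro k
  induction k with
  | zero =>
    intro _
    simp [Function.injective_of_subsingleton]
  | succ k ih =>
    intro hk
    rw [← ih (by omega), ← (Fin.snocEquiv fun _ : Fin (k + 1) => Fin n).sum_comp,
      Fintype.sum_prod_type_right]
    refine Finset.sum_congr rfl fun x _ => ?_
    by_cases hx : Function.Injective x
    swap
    · rw [if_neg hx]
      refine Finset.sum_eq_zero fun v _ => if_neg fun h => hx ?_
      have := h.comp (Fin.castSucc_injective k)
      convert this using 1
      ext j
      simp [Fin.snocEquiv]
    rw [if_pos hx]
    set S : Finset (Fin n) := Finset.univ.image x with hS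
    have hSsum : ∑ i ∈ S, w i = ∑ l, w (x l) := by
      rw [hS, Finset.sum_image fun a _ b _ h => hx h]
    have hcard : S.card < (Finset.univ : Finset (Fin n)).card := by
      calc S.card ≤ (Finset.univ : Finset (Fin k)).card := Finset.card_image_le
        _ < _ := by simp; omega
    have hT : ∑ i ∈ Sᶜ, w i = ∑ i, w i - ∑ l, w (x l) := by
      rw [← hSsum, ← Finset.sum_add_sum_compl S w]; ring
    have hTpos : 0 < ∑ i ∈ Sᶜ, w i := by
      refine Finset.sum_pos (fun i _ => hw i) ?_
      rw [← Finset.card_pos, Finset.card_compl]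
      simp only [Finset.card_univ] at hcard
      omega
    set P := ∏ j, w (x j) /
      (∑ i, w i - ∑ l ∈ Finset.univ.filter (fun l : Fin k => l < j), w (x l)) with hP
    have hterm : ∀ v : Fin n, (if Function.Injective
          ((Fin.snocEquiv fun _ : Fin (k + 1) => Fin n) (v, x)) then
        ∏ j, w ((Fin.snocEquiv fun _ : Fin (k + 1) => Fin n) (v, x) j) /
          (∑ i, w i - ∑ l ∈ Finset.univ.filter (fun l : Fin (k + 1) => l < j),
            w ((Fin.snocEquiv fun _ : Fin (k + 1) => Fin n) (v, x) l)) else 0)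
        = if v ∈ Sᶜ then P * (w v / ∑ i ∈ Sᶜ, w i) else 0 := by
      intro v
      have hiff : Function.Injective ((Fin.snocEquiv fun _ : Fin (k + 1) => Fin n) (v, x)) ↔
          v ∈ Sᶜ := by
        have : (Fin.snocEquiv fun _ : Fin (k + 1) => Fin n) (v, x)
            = (Fin.snoc x v : Fin (k + 1) → Fin n) := rfl
        rw [this, Fin.snoc_injective_iff]
        simp [hS, hx]
      rw [if_congr hiff rfl rfl]
      refine if_congr Iff.rfl ?_ rfl
      rw [Fin.prod_univ_castSucc]
      simp only [Finset.sum_filter, Fin.sum_univ_castSucc, Fin.snocEquiv_apply,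
        Fin.snoc_castSucc, Fin.snoc_last, Fin.castSucc_lt_castSucc_iff, Fin.castSucc_lt_last,
        lt_irrefl, if_true, if_false, add_zero, hP, hT]
      congr 1
      refine Finset.prod_congr rfl fun j _ => ?_
      rw [if_neg (by simpa using (Fin.castSucc_lt_last j).le), add_zero]
    rw [Finset.sum_congr rfl fun v _ => hterm v, ← Finset.sum_filter]
    simp only [Finset.filter_mem_eq_inter, Finset.univ_inter]
    rw [← Finset.mul_sum, ← Finset.sum_div, div_self hTpos.ne', mul_one]

theorem sum_clauseMass (β : ℝ) {n k : ℕ} (hk : k ≤ n) :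
    ∑ c : Draw n k, clauseMass β k c = 1 := by
  rw [Fintype.sum_prod_type, ← sum_prod_div_eq_one (wt_pos β (n := n)) k hk]
  refine Finset.sum_congr rfl fun x _ => ?_
  by_cases hx : Function.Injective x
  · simp only [clauseMass, hx, if_true, Finset.sum_const, Finset.card_univ, Fintype.card_pi,
      Fintype.card_bool, Finset.prod_const, Fintype.card_fin, nsmul_eq_mul, totalWt]
    push_cast
    rw [← mul_assoc, ← mul_pow, mul_one_div_cancel (two_ne_zero' ℝ), one_pow, one_mul]
  · simp [clauseMass, hx]

theorem clauseMass_nonneg (β : ℝ) {n k : ℕ} (c : Draw n k) : 0 ≤ clauseMass β k c := by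
  unfold clauseMass
  split_ifs with h
  · refine mul_nonneg (by positivity) (Finset.prod_nonneg fun j _ => ?_)
    refine div_nonneg (wt_pos β _).le ?_
    rw [sub_nonneg, totalWt, ← Finset.sum_image (f := wt β) (g := c.1) fun a _ b _ h' => h h']
    exact Finset.sum_le_sum_of_subset_of_nonneg (Finset.subset_univ _)
      fun i _ _ => (wt_pos β i).le
  · exact le_rfl

theorem mass_nonneg (β : ℝ) {n m k : ℕ} (φ : Formula n m k) : 0 ≤ mass β φ :=
  Finset.prod_nonneg fun _ _ => clauseMass_nonneg β _

theorem sum_mass (β : ℝ) {n m k : ℕ} (hk : k ≤ n) : ∑ φ : Formula n m k, mass β φ = 1 := by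
  have := Finset.prod_univ_sum (fun _ : Fin m => (Finset.univ : Finset (Draw n k)))
    fun _ c => clauseMass β k c
  simp only [sum_clauseMass β hk, Finset.prod_const_one, Fintype.piFinset_univ] at this
  exact this.symm

theorem Pr_le_one (β : ℝ) {n m k : ℕ} (hk : k ≤ n) (E : Set (Formula n m k)) :
    Pr β n m k E ≤ 1 := by
  rw [← sum_mass β (m := m) hk, Pr]
  refine Finset.sum_le_sum fun φ _ => ?_
  by_cases hφ : φ ∈ E
  · rw [Set.indicator_of_mem hφ]
  · rw [Set.indicator_of_notMem hφ]
    exact mass_nonneg β φ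

theorem Pr_mono (β : ℝ) {n m k : ℕ} {E F : Set (Formula n m k)} (h : E ⊆ F) :
    Pr β n m k E ≤ Pr β n m k F :=
  Finset.sum_le_sum fun φ _ => Set.indicator_le_indicator_of_subset h (mass_nonneg β) φ

theorem Pr_add_Pr_compl (β : ℝ) {n m k : ℕ} (hk : k ≤ n) (E : Set (Formula n m k)) :
    Pr β n m k E + Pr β n m k Eᶜ = 1 := by
  rw [← sum_mass β (m := m) hk, Pr, Pr, ← Finset.sum_add_distrib]
  exact Finset.sum_congr rfl fun φ _ => congrFun (Set.indicator_self_add_compl E (mass β)) φ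

theorem Pr_biUnion_le (β : ℝ) {n m k : ℕ} {ι : Type*} (I : Finset ι)
    (E : ι → Set (Formula n m k)) : Pr β n m k (⋃ i ∈ I, E i) ≤ ∑ i ∈ I, Pr β n m k (E i) := by
  simp only [Pr]
  rw [Finset.sum_comm]
  refine Finset.sum_le_sum fun φ _ => ?_
  by_cases h : φ ∈ ⋃ i ∈ I, E i
  · rw [Set.indicator_of_mem h]
    simp only [Set.mem_iUnion, exists_prop] at h
    obtain ⟨i, hi, hφ⟩ := h
    calc mass β φ = (E i).indicator (mass β) φ := (Set.indicator_of_mem hφ _).symm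
      _ ≤ _ := Finset.single_le_sum (f := fun i => (E i).indicator (mass β) φ)
        (fun i _ => Set.indicator_nonneg (fun φ _ => mass_nonneg β φ) φ) hi
  · rw [Set.indicator_of_notMem h]
    exact Finset.sum_nonneg fun i _ => Set.indicator_nonneg (fun φ _ => mass_nonneg β φ) φ

/-- Resampling the `i`-th clause does not change expectations. -/
theorem sum_mass_mul_eq_resample (β : ℝ) {n m k : ℕ} (hk : k ≤ n) (i : Fin m)
    (G : Formula n m k → ℝ) :
    ∑ φ : Formula n m k, mass β φ * G φ =
      ∑ φ : Formula n m k, mass β φ *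
        ∑ c : Draw n k, clauseMass β k c * G (Function.update φ i c) := by
  have hswap : ∀ (φ : Formula n m k) (c : Draw n k),
      mass β φ * clauseMass β k c
        = mass β (Function.update φ i c) * clauseMass β k (φ i) := by
    intro φ c
    simp only [mass]
    rw [← Finset.mul_prod_erase _ _ (Finset.mem_univ i),
      ← Finset.mul_prod_erase _ (fun j => clauseMass β k (Function.update φ i c j))
        (Finset.mem_univ i), Function.update_self]
    have : ∏ j ∈ Finset.univ.erase i, clauseMass β k (Function.update φ i c j)
        = ∏ j ∈ Finset.univ.erase i, clauseMass β k (φ j) :=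
      Finset.prod_congr rfl fun j hj => by
        rw [Function.update_of_ne (Finset.ne_of_mem_erase hj)]
    rw [this]; ring
  have h1 : ∑ φ : Formula n m k, mass β φ * G φ
      = ∑ p : Formula n m k × Draw n k, mass β p.1 * clauseMass β k p.2 * G p.1 := by
    rw [Fintype.sum_prod_type]
    refine Finset.sum_congr rfl fun φ _ => ?_
    simp only
    rw [← Finset.sum_mul, ← Finset.mul_sum, sum_clauseMass β hk, mul_one]
  have h2 : ∑ φ : Formula n m k, mass β φ *
        ∑ c : Draw n k, clauseMass β k c * G (Function.update φ i c)
      = ∑ p : Formula n m k × Draw n k,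
          mass β p.1 * clauseMass β k p.2 * G (Function.update p.1 i p.2) := by
    rw [Fintype.sum_prod_type]
    refine Finset.sum_congr rfl fun φ _ => ?_
    rw [Finset.mul_sum]
    exact Finset.sum_congr rfl fun c _ => by ring
  rw [h1, h2]
  refine Finset.sum_nbij' (fun p => (Function.update p.1 i p.2, p.1 i))
    (fun p => (Function.update p.1 i p.2, p.1 i)) (by simp) (by simp) (by simp) (by simp) ?_
  intro p _
  simp [hswap p.1 p.2]

/-- Generating function bound for the number of new variables among `k` draws. -/
theorem sum_prod_mul_pow_le {n : ℕ} {q : Fin n → ℝ} (hq : ∀ i, 0 ≤ q i) {B μ : ℝ} (hμ : 0 ≤ μ)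
    (hB : ∑ i, q i ≤ B) {N : ℕ}
    (hN : ∀ V : Finset (Fin n), V.card ≤ N → ∑ i ∈ V, q i ≤ B * μ) :
    ∀ (k : ℕ) (V : Finset (Fin n)), V.card + k ≤ N →
      ∑ x : Fin k → Fin n, (∏ j, q (x j)) * μ ^ (Finset.univ.image x \ V).card
        ≤ (2 * B * μ) ^ k := by
  have hB0 : 0 ≤ B := (Finset.sum_nonneg fun i _ => hq i).trans hB
  intro k
  induction k with
  | zero => intro V _; simp
  | succ k ih =>
    intro V hV
    rw [← (Fin.consEquiv fun _ : Fin (k + 1) => Fin n).sum_comp, Fintype.sum_prod_type]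
    have hstep : ∀ v : Fin n, ∑ x : Fin k → Fin n,
        (∏ j, q ((Fin.consEquiv fun _ : Fin (k + 1) => Fin n) (v, x) j)) *
          μ ^ (Finset.univ.image ((Fin.consEquiv fun _ : Fin (k + 1) => Fin n) (v, x)) \ V).card
        ≤ (q v * μ + if v ∈ V then q v else 0) * (2 * B * μ) ^ k := by
      intro v
      have himg : ∀ x : Fin k → Fin n,
          Finset.univ.image ((Fin.consEquiv fun _ : Fin (k + 1) => Fin n) (v, x))
            = insert v (Finset.univ.image x) := by
        intro x
        ext u
        simp [Fin.exists_fin_succ, Fin.consEquiv_apply, eq_comm]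
      by_cases hv : v ∈ V
      · have h1 := mul_le_mul_of_nonneg_left (ih V (by omega)) (hq v)
        rw [Finset.mul_sum] at h1
        have h2 : q v * (2 * B * μ) ^ k ≤ (q v * μ + q v) * (2 * B * μ) ^ k := by
          have := hq v
          gcongr
          nlinarith
        rw [if_pos hv]
        refine le_trans (le_of_eq ?_) (h1.trans h2)
        refine Finset.sum_congr rfl fun x _ => ?_
        rw [himg, Finset.insert_sdiff_of_mem _ hv, Fin.prod_univ_succ]
        simp [Fin.consEquiv_apply, mul_assoc]
      · have h1 := mul_le_mul_of_nonneg_left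
          (ih (insert v V) ((Nat.add_le_add_right (Finset.card_insert_le v V) k).trans (by omega)))
          (mul_nonneg (hq v) hμ)
        rw [Finset.mul_sum] at h1
        rw [if_neg hv, add_zero]
        refine le_trans (le_of_eq ?_) h1
        refine Finset.sum_congr rfl fun x _ => ?_
        have hset : insert v (Finset.univ.image x) \ V
            = insert v (Finset.univ.image x \ insert v V) := by
          ext u
          simp only [Finset.mem_sdiff, Finset.mem_insert]
          by_cases huv : u = v
          · subst huv; simp [hv]
          · simp [huv]
        rw [himg, hset, Finset.card_insert_of_notMem (by simp), Fin.prod_univ_succ, pow_succ]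
        simp only [Fin.consEquiv_apply, Fin.cons_zero, Fin.cons_succ]
        ring
    refine (Finset.sum_le_sum fun v _ => hstep v).trans ?_
    rw [← Finset.sum_mul, Finset.sum_add_distrib, ← Finset.sum_mul, ← Finset.sum_filter,
      Finset.filter_mem_eq_inter, Finset.univ_inter, pow_succ']
    have h1 := hN V (by omega)
    have h2 := mul_le_mul_of_nonneg_right hB hμ
    gcongr
    linarith

theorem sum_clauseMass_mul_pow_le {β γ : ℝ} (hβ : 2 < β) (hγ : 1 + -1 / (β - 1) = γ)
    (h0 : 0 < γ) (h1 : γ ≤ 1) {n k N : ℕ} (hn : 0 < n) (hnk : 2 * (k : ℝ) ≤ (n : ℝ) ^ γ)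
    (V : Finset (Fin n)) (hV : V.card + k ≤ N) :
    ∑ c : Draw n k, clauseMass β k c *
        (((N : ℝ) / n) ^ γ) ^ (Finset.univ.image c.1 \ V).card
      ≤ (2 * (2 / γ) * ((N : ℝ) / n) ^ γ) ^ k := by
  have hn' : (0 : ℝ) < n := by exact_mod_cast hn
  have hng : (0 : ℝ) < (n : ℝ) ^ γ := by positivity
  set q : Fin n → ℝ := fun i => wt β i / ((n : ℝ) ^ γ / 2) with hq
  set μ : ℝ := ((N : ℝ) / n) ^ γ with hμ
  have hq0 : ∀ i, 0 ≤ q i := fun i => div_nonneg (wt_pos β i).le (by positivity)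
  have hsum : ∀ V : Finset (Fin n), ∑ i ∈ V, q i ≤ 2 / γ * ((V.card : ℝ) / n) ^ γ := by
    intro V
    rw [hq, ← Finset.sum_div, Real.div_rpow (by positivity) hn'.le, div_le_iff₀ (by positivity)]
    refine (sum_wt_le hγ h0 h1 V).trans (le_of_eq ?_)
    field_simp
  have hkey := sum_prod_mul_pow_le hq0 (B := 2 / γ) (μ := μ) (by positivity)
    (by
      refine (hsum Finset.univ).trans (le_of_eq ?_)
      simp [hn'.ne'])
    (N := N) (fun V hV => (hsum V).trans (by rw [hμ]; gcongr)) k V hV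
  refine le_trans ?_ hkey
  rw [Fintype.sum_prod_type]
  refine Finset.sum_le_sum fun x _ => ?_
  have hc : ∀ b : Fin k → Bool, clauseMass β k (x, b) ≤ (1 / 2) ^ k * ∏ j, q (x j) := by
    intro b
    unfold clauseMass
    split_ifs with hx
    · refine mul_le_mul_of_nonneg_left ?_ (by positivity)
      have hden : ∀ j : Fin k, (n : ℝ) ^ γ / 2 ≤ totalWt β n -
          ∑ l ∈ Finset.univ.filter (fun l : Fin k => l < j), wt β (x l) := by
        intro j
        have h2 : ∑ l ∈ Finset.univ.filter (fun l : Fin k => l < j), wt β (x l) ≤ k := by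
          calc ∑ l ∈ Finset.univ.filter (fun l : Fin k => l < j), wt β (x l)
              ≤ ∑ l : Fin k, wt β (x l) :=
                Finset.sum_le_sum_of_subset_of_nonneg (Finset.filter_subset _ _)
                  fun l _ _ => (wt_pos β _).le
            _ ≤ ∑ l : Fin k, (1 : ℝ) := Finset.sum_le_sum fun l _ => wt_le_one hβ _
            _ = k := by simp
        have h3 := rpow_le_totalWt hγ h1 hn
        linarith
      refine Finset.prod_le_prod (fun j _ => div_nonneg (wt_pos β _).le
        (le_trans (by positivity) (hden j))) fun j _ => ?_
      exact div_le_div_of_nonneg_left (wt_pos β _).le (by positivity) (hden j)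
    · exact mul_nonneg (by positivity) (Finset.prod_nonneg fun j _ => hq0 _)
  refine (Finset.sum_le_sum fun b _ => mul_le_mul_of_nonneg_right (hc b) (by positivity)).trans ?_
  simp only [Finset.sum_const, Finset.card_univ, Fintype.card_pi,
      Fintype.card_bool, Finset.prod_const, Fintype.card_fin, nsmul_eq_mul]
  push_cast
  rw [← mul_assoc, ← mul_assoc, ← mul_pow]
  norm_num

theorem sum_mass_mul_pow_card_nbhd_le {β γ : ℝ} (hβ : 2 < β) (hγ : 1 + -1 / (β - 1) = γ)
    (h0 : 0 < γ) (h1 : γ ≤ 1) {n m k N : ℕ} (hn : 0 < n) (hkn : k ≤ n)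
    (hnk : 2 * (k : ℝ) ≤ (n : ℝ) ^ γ) (Cs : Finset (Fin m)) (hCs : k * Cs.card ≤ N) :
    ∑ φ : Formula n m k, mass β φ * (((N : ℝ) / n) ^ γ) ^ (nbhd φ Cs).card
      ≤ ((2 * (2 / γ) * ((N : ℝ) / n) ^ γ) ^ k) ^ Cs.card := by
  classical
  set μ : ℝ := ((N : ℝ) / n) ^ γ with hμ
  induction Cs using Finset.induction_on with
  | empty => simp [nbhd, sum_mass β hkn]
  | insert i Cs hi ih =>
    rw [Finset.card_insert_of_notMem hi] at hCs ⊢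
    have hle : k * Cs.card + k ≤ N := by linarith
    rw [sum_mass_mul_eq_resample β hkn i]
    have hcard : ∀ φ : Formula n m k, (nbhd φ Cs).card ≤ k * Cs.card := by
      intro φ
      rw [mul_comm]
      refine Finset.card_biUnion_le_card_mul _ _ _ fun j _ => ?_
      exact Finset.card_image_le.trans (by simp)
    have hstep : ∀ φ : Formula n m k,
        ∑ c : Draw n k, clauseMass β k c *
            μ ^ (nbhd (Function.update φ i c) (insert i Cs)).card
          ≤ μ ^ (nbhd φ Cs).card * (2 * (2 / γ) * μ) ^ k := by
      intro φ
      have hb := sum_clauseMass_mul_pow_le hβ hγ h0 h1 (N := N) hn hnk (nbhd φ Cs)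
        (by have := hcard φ; omega)
      have hb' := mul_le_mul_of_nonneg_left hb
        (by positivity : (0 : ℝ) ≤ μ ^ (nbhd φ Cs).card)
      rw [Finset.mul_sum] at hb'
      refine le_trans (le_of_eq ?_) hb'
      refine Finset.sum_congr rfl fun c _ => ?_
      have hset : nbhd (Function.update φ i c) (insert i Cs)
          = nbhd φ Cs ∪ (Finset.univ.image c.1 \ nbhd φ Cs) := by
        rw [Finset.union_sdiff_self_eq_union]
        unfold nbhd
        rw [Finset.biUnion_insert, Function.update_self, Finset.union_comm]
        congr 1
        refine Finset.biUnion_congr rfl fun j hj => ?_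
        rw [Function.update_of_ne fun h : j = i => hi (h ▸ hj)]
      rw [hset, Finset.card_union_of_disjoint Finset.disjoint_sdiff, pow_add]
      ring
    calc _ ≤ ∑ φ : Formula n m k, mass β φ *
          (μ ^ (nbhd φ Cs).card * (2 * (2 / γ) * μ) ^ k) :=
          Finset.sum_le_sum fun φ _ => mul_le_mul_of_nonneg_left (hstep φ) (mass_nonneg β φ)
      _ = (∑ φ : Formula n m k, mass β φ * μ ^ (nbhd φ Cs).card) * (2 * (2 / γ) * μ) ^ k := by
          rw [Finset.sum_mul]
          exact Finset.sum_congr rfl fun φ _ => by ring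
      _ ≤ _ := by
          rw [pow_succ]
          exact mul_le_mul_of_nonneg_right (ih (by omega)) (by positivity)

/-- A fixed set of `s` clauses is unlikely to have fewer than `(1 + c) s` neighbors. -/
theorem Pr_card_nbhd_lt_le {β γ c : ℝ} (hβ : 2 < β) (hγ : 1 + -1 / (β - 1) = γ)
    (h0 : 0 < γ) (h1 : γ ≤ 1) {n m k : ℕ} (hk : 0 < k) (hn : 0 < n) (hkn : k ≤ n)
    (hnk : 2 * (k : ℝ) ≤ (n : ℝ) ^ γ) (Cs : Finset (Fin m)) (hCs : k * Cs.card ≤ n)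
    (hpos : 0 < Cs.card) :
    Pr β n m k {φ | ((nbhd φ Cs).card : ℝ) < (1 + c) * Cs.card}
      ≤ ((4 / γ) ^ k * ((k : ℝ) * Cs.card / n) ^ (γ * (k - 1 - c))) ^ Cs.card := by
  have hn' : (0 : ℝ) < n := by exact_mod_cast hn
  set s := Cs.card with hs
  have hρ : (0 : ℝ) < (k : ℝ) * s / n := by positivity
  have hρ1 : (k : ℝ) * s / n ≤ 1 := by
    rw [div_le_one hn']; exact_mod_cast hCs
  set ρ : ℝ := (k : ℝ) * s / n with hρdef
  set μ : ℝ := ρ ^ γ with hμ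
  have hμ0 : 0 < μ := by positivity
  have hμ1 : μ ≤ 1 := Real.rpow_le_one hρ.le hρ1 h0.le
  have hgen := sum_mass_mul_pow_card_nbhd_le hβ hγ h0 h1 (N := k * s) hn hkn hnk Cs le_rfl
  rw [← hs] at hgen
  push_cast at hgen
  rw [← hρdef, ← hμ] at hgen
  have hmark : Pr β n m k {φ | ((nbhd φ Cs).card : ℝ) < (1 + c) * s} * μ ^ ((1 + c) * s)
      ≤ ∑ φ : Formula n m k, mass β φ * μ ^ (nbhd φ Cs).card := by
    rw [Pr, Finset.sum_mul]
    refine Finset.sum_le_sum fun φ _ => ?_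
    by_cases hφ : φ ∈ {φ : Formula n m k | ((nbhd φ Cs).card : ℝ) < (1 + c) * s}
    · rw [Set.indicator_of_mem hφ]
      refine mul_le_mul_of_nonneg_left ?_ (mass_nonneg β φ)
      rw [← Real.rpow_natCast]
      exact Real.rpow_le_rpow_of_exponent_ge hμ0 hμ1 (le_of_lt hφ)
    · rw [Set.indicator_of_notMem hφ, zero_mul]
      exact mul_nonneg (mass_nonneg β φ) (by positivity)
  have hmain := hmark.trans hgen
  rw [← le_div_iff₀ (by positivity)] at hmain
  refine hmain.trans (le_of_eq ?_)
  rw [div_eq_iff (by positivity)]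
  have e1 : ρ ^ (γ * (k - 1 - c)) = μ ^ ((k : ℝ) - 1 - c) := by
    rw [hμ, ← Real.rpow_mul hρ.le]
  have e2 : μ ^ ((1 + c) * (s : ℝ)) = (μ ^ (1 + c)) ^ s := by
    rw [Real.rpow_mul hμ0.le, Real.rpow_natCast]
  rw [e1, e2, ← mul_pow, mul_assoc ((4 / γ) ^ k), ← Real.rpow_add hμ0]
  congr 1
  have e3 : (k : ℝ) - 1 - c + (1 + c) = k := by ring
  rw [e3, Real.rpow_natCast, ← mul_pow]
  congr 1
  ring

theorem choose_le_exp_mul_div_pow (m s : ℕ) (hs : 0 < s) :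
    (m.choose s : ℝ) ≤ (Real.exp 1 * (m / s)) ^ s := by
  have hs' : (0 : ℝ) < s := by exact_mod_cast hs
  have h1 : (m.choose s : ℝ) ≤ (m : ℝ) ^ s / (s.factorial : ℝ) := Nat.choose_le_pow_div s m
  have h2 := Real.pow_div_factorial_le_exp (s : ℝ) hs'.le s
  have h3 : (m : ℝ) ^ s / (s.factorial : ℝ) = (m / s : ℝ) ^ s * ((s : ℝ) ^ s / s.factorial) := by
    rw [div_pow]; field_simp
  rw [h3] at h1
  refine h1.trans ?_
  rw [mul_pow, ← Real.exp_nat_mul, mul_one, mul_comm (Real.exp _)]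
  gcongr

/-- The random formula is an expander, up to a small error probability. -/
theorem Pr_not_isBipartiteExpander_le {β γ c ε : ℝ} (hβ : 2 < β) (hγ : 1 + -1 / (β - 1) = γ)
    (h0 : 0 < γ) (h1 : γ ≤ 1) {n m k r : ℕ} (hk : 0 < k) (hn : 0 < n) (hkn : k ≤ n)
    (hnk : 2 * (k : ℝ) ≤ (n : ℝ) ^ γ) (hr : k * r ≤ n) (hc : γ * (k - 1 - c) = 1 + ε) :
    Pr β n m k {φ | ¬ IsBipartiteExpander φ r c} ≤ ∑ s ∈ Finset.Icc 1 r,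
      (Real.exp 1 * (4 / γ) ^ k * (k : ℝ) ^ (1 + ε) * ((m : ℝ) / n) * ((s : ℝ) / n) ^ ε) ^ s := by
  have hn' : (0 : ℝ) < n := by exact_mod_cast hn
  have hk' : (0 : ℝ) < k := by exact_mod_cast hk
  have hsub : {φ : Formula n m k | ¬ IsBipartiteExpander φ r c} ⊆
      ⋃ s ∈ Finset.Icc 1 r, ⋃ Cs ∈ Finset.powersetCard s (Finset.univ : Finset (Fin m)),
        {φ | ((nbhd φ Cs).card : ℝ) < (1 + c) * Cs.card} := by
    intro φ hφ
    simp only [IsBipartiteExpander, Set.mem_ofPred_eq, not_forall, not_le, exists_prop] at hφ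
    obtain ⟨Cs, hCs, hlt⟩ := hφ
    have hpos : 1 ≤ Cs.card := by
      by_contra! h
      have h' : Cs.card = 0 := by omega
      rw [h', Nat.cast_zero, mul_zero] at hlt
      exact absurd hlt (Nat.cast_nonneg _).not_gt
    simp only [Set.mem_iUnion, exists_prop, Finset.mem_Icc, Finset.mem_powersetCard_univ]
    exact ⟨Cs.card, ⟨hpos, hCs⟩, Cs, rfl, hlt⟩
  refine (Pr_mono β hsub).trans ((Pr_biUnion_le β _ _).trans (Finset.sum_le_sum fun s hs => ?_))
  rw [Finset.mem_Icc] at hs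
  have hs' : (0 : ℝ) < s := by exact_mod_cast hs.1
  have hks : k * s ≤ n := (Nat.mul_le_mul_left k hs.2).trans hr
  have hterm : ∀ Cs ∈ Finset.powersetCard s (Finset.univ : Finset (Fin m)),
      Pr β n m k {φ | ((nbhd φ Cs).card : ℝ) < (1 + c) * Cs.card}
        ≤ ((4 / γ) ^ k * ((k : ℝ) * s / n) ^ (1 + ε)) ^ s := by
    intro Cs hCs
    rw [Finset.mem_powersetCard_univ] at hCs
    have := Pr_card_nbhd_lt_le (c := c) hβ hγ h0 h1 hk hn hkn hnk Cs (by rw [hCs]; exact hks)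
      (by rw [hCs]; exact hs.1)
    simpa only [hCs, hc] using this
  refine (Pr_biUnion_le β _ _).trans ((Finset.sum_le_sum hterm).trans ?_)
  rw [Finset.sum_const, Finset.card_powersetCard, Finset.card_univ, Fintype.card_fin,
    nsmul_eq_mul]
  refine (mul_le_mul_of_nonneg_right (choose_le_exp_mul_div_pow m s hs.1)
    (by positivity)).trans (le_of_eq ?_)
  rw [← mul_pow]
  congr 1
  have hsn : (0 : ℝ) < (s : ℝ) / n := by positivity
  rw [mul_div_assoc, Real.mul_rpow hk'.le hsn.le, Real.rpow_add hsn, Real.rpow_one]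
  field_simp

theorem tendsto_sum_pow_zero {a : ℕ → ℝ} {r : ℕ → ℕ} {ε : ℝ} (hε : 0 < ε) (ha : ∀ n, 0 ≤ a n)
    (hr : ∀ᶠ n : ℕ in atTop, a n * ((r n : ℝ) / n) ^ ε ≤ 1 / 2)
    (hlim : Tendsto (fun n : ℕ => a n / (n : ℝ) ^ ε) atTop (nhds 0)) :
    Tendsto (fun n : ℕ => ∑ s ∈ Finset.Icc 1 (r n), (a n * ((s : ℝ) / n) ^ ε) ^ s)
      atTop (nhds 0) := by
  have hx0 : ∀ n s : ℕ, 0 ≤ a n * ((s : ℝ) / n) ^ ε := fun n s =>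
    mul_nonneg (ha n) (by positivity)
  have h := tendsto_tsum_of_dominated_convergence (𝓕 := atTop)
    (f := fun (n s : ℕ) => if s ∈ Finset.Icc 1 (r n) then (a n * ((s : ℝ) / n) ^ ε) ^ s else 0)
    (g := fun _ => (0 : ℝ)) (bound := fun s : ℕ => (1 / 2 : ℝ) ^ s)
    summable_geometric_two ?_ ?_
  · rw [tsum_zero] at h
    refine h.congr fun n => ?_
    rw [tsum_eq_sum (s := Finset.Icc 1 (r n)) fun s hs => if_neg hs]
    exact Finset.sum_congr rfl fun s hs => if_pos hs
  · intro s
    rcases Nat.eq_zero_or_pos s with rfl | hs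
    · simp
    have h1 : Tendsto (fun n : ℕ => a n * ((s : ℝ) / n) ^ ε) atTop (nhds 0) := by
      have := hlim.mul_const ((s : ℝ) ^ ε)
      rw [zero_mul] at this
      refine this.congr fun n => ?_
      rw [Real.div_rpow (by positivity) (by positivity)]
      ring
    have h2 := h1.pow s
    rw [zero_pow hs.ne'] at h2
    refine squeeze_zero (fun n => ?_) (fun n => ?_) h2
    · split_ifs
      · exact pow_nonneg (hx0 n s) s
      · exact le_rfl
    · split_ifs
      · exact le_rfl
      · exact pow_nonneg (hx0 n s) s
  · filter_upwards [hr] with n hn s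
    split_ifs with hs
    · rw [Finset.mem_Icc] at hs
      rw [Real.norm_of_nonneg (pow_nonneg (hx0 n s) s)]
      refine pow_le_pow_left₀ (hx0 n s) (le_trans ?_ hn) s
      have := hs.2
      have := ha n
      gcongr
    · rw [norm_zero]; positivity

/-- The random formula is asymptotically almost surely an expander for sets of up to
`δ n Δ ^ (-1 / ε)` clauses. -/
theorem exists_tendsto_Pr_not_isBipartiteExpander {β γ c ε : ℝ} (hβ : 2 < β)
    (hγ : 1 + -1 / (β - 1) = γ) (h0 : 0 < γ) (h1 : γ ≤ 1) {k : ℕ} (hk : 0 < k) (hε : 0 < ε)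
    (hc : γ * (k - 1 - c) = 1 + ε) {m : ℕ → ℕ} {c₀ : ℝ} (hc₀ : 0 < c₀)
    (hm : ∀ᶠ n : ℕ in atTop, c₀ ≤ (m n : ℝ) / n)
    (hlim : Tendsto (fun n : ℕ => (m n : ℝ) / n / (n : ℝ) ^ ε) atTop (nhds 0)) :
    ∃ δ > (0 : ℝ), Tendsto (fun n : ℕ => Pr β n (m n) k {φ | ¬ IsBipartiteExpander φ
      ⌊δ * (n * ((m n : ℝ) / n) ^ (-1 / ε))⌋₊ c}) atTop (nhds 0) := by
  have hk' : (0 : ℝ) < k := by exact_mod_cast hk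
  set K : ℝ := Real.exp 1 * (4 / γ) ^ k * (k : ℝ) ^ (1 + ε) with hK
  have hK0 : 0 < K := by positivity
  refine ⟨min ((2 * K) ^ (-1 / ε)) (c₀ ^ (1 / ε) / k), by positivity, ?_⟩
  set δ : ℝ := min ((2 * K) ^ (-1 / ε)) (c₀ ^ (1 / ε) / k) with hδ
  have hδ0 : 0 < δ := by positivity
  set r : ℕ → ℕ := fun n => ⌊δ * (n * ((m n : ℝ) / n) ^ (-1 / ε))⌋₊ with hr
  have hrle : ∀ n : ℕ, 0 < n → (r n : ℝ) / n ≤ δ * ((m n : ℝ) / n) ^ (-1 / ε) := by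
    intro n hn
    have hn' : (0 : ℝ) < n := by exact_mod_cast hn
    rw [div_le_iff₀ hn']
    refine (Nat.floor_le (by positivity)).trans (le_of_eq (by ring))
  have hδε : δ ^ ε ≤ 1 / (2 * K) := by
    calc δ ^ ε ≤ ((2 * K) ^ (-1 / ε)) ^ ε := by
          gcongr; exact min_le_left _ _
      _ = 1 / (2 * K) := by
          rw [← Real.rpow_mul (by positivity), div_mul_cancel₀ _ hε.ne', Real.rpow_neg_one,
            one_div]
  have hzero := tendsto_sum_pow_zero (a := fun n => K * ((m n : ℝ) / n)) (r := r) hε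
    (fun n => by positivity) (by
      filter_upwards [hm, eventually_gt_atTop 0] with n hmn hn
      have hΔ : 0 < (m n : ℝ) / n := hc₀.trans_le hmn
      calc K * ((m n : ℝ) / n) * ((r n : ℝ) / n) ^ ε
          ≤ K * ((m n : ℝ) / n) * (δ * ((m n : ℝ) / n) ^ (-1 / ε)) ^ ε := by
            have := hrle n hn
            gcongr
        _ = K * δ ^ ε := by
            rw [Real.mul_rpow hδ0.le (by positivity), ← Real.rpow_mul hΔ.le,
              div_mul_cancel₀ _ hε.ne', Real.rpow_neg_one]
            rw [mul_mul_mul_comm, mul_inv_cancel₀ hΔ.ne', mul_one]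
        _ ≤ K * (1 / (2 * K)) := by gcongr
        _ = 1 / 2 := by field_simp)
    (by
      have := hlim.const_mul K
      rw [mul_zero] at this
      exact this.congr fun n => by rw [mul_div_assoc])
  have hlarge : ∀ᶠ n : ℕ in atTop, 2 * (k : ℝ) ≤ (n : ℝ) ^ γ :=
    ((tendsto_rpow_atTop h0).comp tendsto_natCast_atTop_atTop).eventually_ge_atTop _
  refine tendsto_of_tendsto_of_tendsto_of_le_of_le' tendsto_const_nhds hzero ?_ ?_
  · exact Eventually.of_forall fun n => Finset.sum_nonneg fun φ _ =>
      Set.indicator_nonneg (fun φ _ => mass_nonneg β φ) φ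
  · filter_upwards [hm, eventually_gt_atTop 0, eventually_ge_atTop k, hlarge] with n hmn hn hkn hnk
    have hn' : (0 : ℝ) < n := by exact_mod_cast hn
    refine Pr_not_isBipartiteExpander_le hβ hγ h0 h1 hk hn hkn hnk ?_ hc
    have hΔ : ((m n : ℝ) / n) ^ (-1 / ε) ≤ c₀ ^ (-1 / ε) :=
      Real.rpow_le_rpow_of_nonpos hc₀ hmn
        (div_nonpos_of_nonpos_of_nonneg (by norm_num) hε.le)
    have h2 : (r n : ℝ) / n ≤ 1 / k := by
      calc (r n : ℝ) / n ≤ δ * ((m n : ℝ) / n) ^ (-1 / ε) := hrle n hn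
        _ ≤ c₀ ^ (1 / ε) / k * c₀ ^ (-1 / ε) := by
          gcongr; exact min_le_right _ _
        _ = 1 / k := by
          rw [div_mul_eq_mul_div, ← Real.rpow_add hc₀, ← add_div]
          simp
    rw [div_le_div_iff₀ hn' hk'] at h2
    have h3 : ((k * r n : ℕ) : ℝ) ≤ n := by push_cast; linarith
    exact Nat.cast_le.1 h3

theorem tendsto_mul_rpow_neg_one_div_atTop {ε : ℝ} (hε : 0 < ε) {Δ : ℕ → ℝ}
    (hpos : ∀ᶠ n in atTop, 0 < Δ n)
    (hlim : Tendsto (fun n : ℕ => Δ n / (n : ℝ) ^ ε) atTop (nhds 0)) :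
    Tendsto (fun n : ℕ => (n : ℝ) * Δ n ^ (-1 / ε)) atTop atTop := by
  have h1 : Tendsto (fun n : ℕ => Δ n / (n : ℝ) ^ ε) atTop (nhdsWithin 0 (Set.Ioi 0)) := by
    refine tendsto_nhdsWithin_iff.2 ⟨hlim, ?_⟩
    filter_upwards [hpos, eventually_gt_atTop 0] with n hn hn0
    have hn' : (0 : ℝ) < n := by exact_mod_cast hn0
    exact div_pos hn (by positivity)
  have h2 := (tendsto_rpow_atTop (one_div_pos.2 hε)).comp h1.inv_tendsto_nhdsGT_zero
  refine h2.congr' ?_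
  filter_upwards [hpos] with n hn
  simp only [Function.comp, Pi.inv_apply]
  rw [inv_div, Real.div_rpow (by positivity) hn.le, ← Real.rpow_mul (by positivity),
    mul_one_div_cancel hε.ne', Real.rpow_one, neg_div, Real.rpow_neg hn.le, div_eq_mul_inv]

theorem tendsto_div_rpow_of_isLittleO {ε : ℝ} (hε : 0 < ε) {Δ : ℕ → ℝ}
    (hΔ : Δ =o[atTop] fun n : ℕ => ((n : ℝ) / Real.log n) ^ ε) :
    Tendsto (fun n : ℕ => Δ n / (n : ℝ) ^ ε) atTop (nhds 0) := by
  refine (hΔ.trans_isBigO ?_).tendsto_div_nhds_zero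
  refine Asymptotics.IsBigO.of_bound 1 ?_
  filter_upwards [eventually_ge_atTop 3] with n hn
  have hn3 : (3 : ℝ) ≤ n := by exact_mod_cast hn
  have hlog : 1 ≤ Real.log n := by
    rw [Real.le_log_iff_exp_le (by linarith)]
    linarith [Real.exp_one_lt_d9]
  have hle : (n : ℝ) / Real.log n ≤ n := div_le_self (by linarith) hlog
  have hnn : 0 ≤ (n : ℝ) / Real.log n := by positivity
  rw [one_mul, Real.norm_of_nonneg (by positivity), Real.norm_of_nonneg (by positivity)]
  gcongr

end PLSAT

open PLSAT in
/-- **Tree-like resolution size lower bound (Corollary 5.11).**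
For a random power-law `k`-SAT formula with `m ∈ Ω(n)` clauses, `k ≥ 3`,
`β > (2k-3)/(k-2)`, density `Δ = m/n` large enough for unsatisfiability with
constant probability, any constant `0 < ε < (k-1)(β-2)/(β-1) - 1` and
`Δ ∈ o((n/log n)^ε)`, asymptotically almost surely the tree-like resolution size
of `Φ` is `exp(Ω(n · Δ^{-1/ε}))`, i.e. every tree-like resolution refutation has
at least `exp(C · n · Δ^{-1/ε})` nodes. -/
theorem power_law_treelike_resolution_size
    (k : ℕ) (hk : 3 ≤ k) (β : ℝ)
    (hβ : (2 * (k : ℝ) - 3) / ((k : ℝ) - 2) < β)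
    (m : ℕ → ℕ)
    (hm : ∃ c > (0 : ℝ), ∀ᶠ n : ℕ in atTop, c * (n : ℝ) ≤ (m n : ℝ))
    (Δ : ℕ → ℝ) (hΔ : ∀ n : ℕ, Δ n = (m n : ℝ) / (n : ℝ))
    (hunsat : ∃ c > (0 : ℝ), ∀ᶠ n : ℕ in atTop,
      c ≤ Pr β n (m n) k {φ | Unsat φ})
    (ε : ℝ) (hε : 0 < ε)
    (hεub : ε < ((k : ℝ) - 1) * (β - 2) / (β - 1) - 1)
    (hΔo : Δ =o[atTop] fun n : ℕ => ((n : ℝ) / Real.log n) ^ ε) :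
    ∃ C > (0 : ℝ), Tendsto (fun n : ℕ => Pr β n (m n) k
        {φ | ∀ s : ℕ, TreeDeriv (cnf φ) (∅ : RClause n) s →
            Real.exp (C * ((n : ℝ) * Δ n ^ (-1 / ε))) ≤ (s : ℝ)})
      atTop (nhds 1) := by
  classical
  obtain ⟨c₀, hc₀, hm⟩ := hm
  have hk3 : (3 : ℝ) ≤ k := by exact_mod_cast hk
  have hβ2 : 2 < β := by
    refine lt_trans ?_ hβ
    rw [lt_div_iff₀ (by linarith)]
    linarith
  set γ : ℝ := 1 + -1 / (β - 1) with hγ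
  have hγ' : γ = (β - 2) / (β - 1) := by
    have : β - 1 ≠ 0 := by linarith
    rw [hγ]; field_simp; ring
  have h0 : 0 < γ := by rw [hγ']; exact div_pos (by linarith) (by linarith)
  have h1 : γ ≤ 1 := by rw [hγ', div_le_one (by linarith)]; linarith
  obtain ⟨c, hcdef⟩ : ∃ c : ℝ, c = (k : ℝ) - 1 - (1 + ε) / γ := ⟨_, rfl⟩
  have hc : γ * (k - 1 - c) = 1 + ε := by rw [hcdef]; field_simp; ring
  have hcpos : 0 < c := by
    rw [mul_div_assoc, ← hγ'] at hεub
    have : (1 + ε) / γ < k - 1 := by rw [div_lt_iff₀ h0]; linarith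
    linarith
  have hlim := tendsto_div_rpow_of_isLittleO hε hΔo
  have hΔge : ∀ᶠ n : ℕ in atTop, c₀ ≤ Δ n := by
    filter_upwards [hm, eventually_gt_atTop 0] with n hn hn0
    have hn' : (0 : ℝ) < n := by exact_mod_cast hn0
    rw [hΔ, le_div_iff₀ hn']
    exact hn
  have hX := tendsto_mul_rpow_neg_one_div_atTop hε (hΔge.mono fun n hn => hc₀.trans_le hn) hlim
  obtain ⟨δ, hδ, hbad⟩ := exists_tendsto_Pr_not_isBipartiteExpander hβ2 hγ.symm h0 h1
    (by omega) hε hc hc₀ (by simpa only [hΔ] using hΔge) (by simpa only [hΔ] using hlim)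
  simp only [← hΔ] at hbad
  refine ⟨Real.log 2 * (c * δ / 8), by positivity, ?_⟩
  have hlow := hbad.const_sub 1
  rw [sub_zero] at hlow
  refine tendsto_of_tendsto_of_tendsto_of_le_of_le' hlow tendsto_const_nhds ?_ ?_
  swap
  · filter_upwards [eventually_ge_atTop k] with n hn using Pr_le_one β hn _
  have hbig : Tendsto (fun n : ℕ => c * δ / 8 * ((n : ℝ) * Δ n ^ (-1 / ε))) atTop atTop :=
    hX.const_mul_atTop (by positivity)
  filter_upwards [eventually_ge_atTop k, (hX.const_mul_atTop hδ).eventually_ge_atTop 1,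
    hbig.eventually_ge_atTop ((k : ℝ) + 1 + c)] with n hn hr1 hbn
  have hadd := Pr_add_Pr_compl β hn
    {φ : Formula n (m n) k | IsBipartiteExpander φ ⌊δ * ((n : ℝ) * Δ n ^ (-1 / ε))⌋₊ c}
  rw [Set.compl_ofPred] at hadd
  refine le_trans (by linarith) (Pr_mono β (E := {φ : Formula n (m n) k |
    IsBipartiteExpander φ ⌊δ * ((n : ℝ) * Δ n ^ (-1 / ε))⌋₊ c}) fun φ hφ s hs => ?_)
  change IsBipartiteExpander φ _ c at hφ
  set X : ℝ := (n : ℝ) * Δ n ^ (-1 / ε) with hXdef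
  set t : ℕ := ⌈c * δ / 8 * X⌉₊ with ht
  have hfloor := Nat.lt_floor_add_one (δ * X)
  have hceil := Nat.ceil_lt_add_one (show 0 ≤ c * δ / 8 * X by linarith)
  have hsize := hφ.two_pow_le_treeSize hcpos (t := t) (by
    push_cast
    have h2 : c * (δ * X) < c * (⌊δ * X⌋₊ + 1) := by gcongr
    nlinarith) (Nat.le_floor (by simpa using hr1)) hs
  calc Real.exp (Real.log 2 * (c * δ / 8) * X) = Real.exp (Real.log 2 * (c * δ / 8 * X)) := by
        rw [mul_assoc]
    _ ≤ Real.exp (Real.log 2 * t) := by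
        have := Nat.le_ceil (c * δ / 8 * X)
        have := Real.log_nonneg (one_le_two (α := ℝ))
        gcongr
    _ = (2 : ℝ) ^ t := by
        rw [mul_comm, Real.exp_nat_mul, Real.exp_log (by norm_num)]
    _ ≤ s := by exact_mod_cast hsize
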